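/- Let k be a field, R = k[x_1,…,x_d], and I a nonzero proper strongly stable monomial ideal with minimal monomial generating set G(I). Then the height of I equals max{ min(v) : v ∈ log(G(I)) }, where for an exponent vector v, min(v) denotes the smallest index i such that v_i ≠ 0, and log(G(I)) is the set of exponent vectors of the minimal monomial generators of I. -/

import Mathlib

open MvPolynomial

/-- Strongly stable monomial ideal. -/
def StronglyStable {d : ℕ} {k : Type*} [Field k]
    (I : Ideal (MvPolynomial (Fin d) k)) : Prop :=
  ∀ v : Fin d →₀ ℕ, monomial v (1 : k) ∈ I → ∀ i j : Fin d, i < j → v j ≠ 0 →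
    monomial (v + Finsupp.single i 1 - Finsupp.single j 1) (1 : k) ∈ I

/-- `I` is a monomial ideal: it is generated by monomials. -/
def IsMonomialIdeal {d : ℕ} {k : Type*} [Field k]
    (I : Ideal (MvPolynomial (Fin d) k)) : Prop :=
  ∃ S : Set (Fin d →₀ ℕ), I = Ideal.span ((fun v => monomial v (1 : k)) '' S)

/-- Exponent vectors of the minimal monomial generators of a monomial ideal: the
monomials of `I` minimal with respect to divisibility. -/
def MinGens {d : ℕ} {k : Type*} [Field k]
    (I : Ideal (MvPolynomial (Fin d) k)) : Set (Fin d →₀ ℕ) :=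
  {v | monomial v (1 : k) ∈ I ∧ ∀ w : Fin d →₀ ℕ, w ≤ v → monomial w (1 : k) ∈ I → w = v}

/-- Height of an ideal: infimum of the heights of the primes containing it. -/
noncomputable def idealHeight {R : Type*} [CommRing R] (I : Ideal R) : ℕ∞ :=
  ⨅ p ∈ {p : PrimeSpectrum R | I ≤ p.asIdeal}, Order.height p

namespace MvPolynomial

variable {σ k : Type*} [Field k]

theorem isPrime_span_X_image (s : Set σ) :
    (Ideal.span (X '' s : Set (MvPolynomial σ k))).IsPrime := by
  classical
  set P := Ideal.span (X '' s : Set (MvPolynomial σ k))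
  let φ : MvPolynomial σ k →ₐ[k] MvPolynomial σ k := aeval fun i => if i ∈ s then 0 else X i
  have hφ : (Ideal.Quotient.mkₐ k P).comp φ = Ideal.Quotient.mkₐ k P := by
    ext i
    by_cases hi : i ∈ s
    · have : (Ideal.Quotient.mk P) (X i) = 0 :=
        Ideal.Quotient.eq_zero_iff_mem.2 (Ideal.subset_span ⟨i, hi, rfl⟩)
      simp [φ, hi, this]
    · simp [φ, hi]
  have hker : P = RingHom.ker φ := by
    refine le_antisymm (Ideal.span_le.2 ?_) fun f hf => ?_
    · rintro _ ⟨i, hi, rfl⟩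
      simp [RingHom.mem_ker, φ, hi]
    · have h := DFunLike.congr_fun hφ f
      rw [AlgHom.comp_apply, (RingHom.mem_ker).1 hf, map_zero] at h
      exact Ideal.Quotient.eq_zero_iff_mem.1 h.symm
  rw [hker]
  exact RingHom.ker_isPrime _

theorem X_mem_span_X_image {s : Set σ} {i : σ} :
    (X i : MvPolynomial σ k) ∈ Ideal.span (X '' s) ↔ i ∈ s := by
  classical
  simp [mem_ideal_span_X_image, support_X, Finsupp.single_apply]

theorem height_span_X_image [Finite σ] (s : Finset σ) :
    (Ideal.span (X '' (s : Set σ) : Set (MvPolynomial σ k))).height = s.card := by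
  classical
  apply le_antisymm
  · refine (Ideal.height_le_spanFinrank _ (isPrime_span_X_image _).ne_top).trans ?_
    refine (Submodule.spanFinrank_span_le_encard _).trans ?_
    exact (Set.encard_image_le _ _).trans (by simp)
  · induction s using Finset.induction_on with
    | empty => simp
    | insert a s ha ih =>
      have := isPrime_span_X_image (k := k) (s : Set σ)
      have := isPrime_span_X_image (k := k) ((insert a s : Finset σ) : Set σ)
      have hlt : Ideal.span (X '' (s : Set σ) : Set (MvPolynomial σ k)) <
          Ideal.span (X '' ((insert a s : Finset σ) : Set σ)) := by
        refine lt_of_le_of_ne (Ideal.span_mono (Set.image_mono (by simp))) fun h => ha ?_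
        have hmem : (X a : MvPolynomial σ k) ∈
            Ideal.span (X '' ((insert a s : Finset σ) : Set σ)) :=
          X_mem_span_X_image.2 (by simp)
        rw [← h] at hmem
        simpa using X_mem_span_X_image.1 hmem
      rw [Finset.card_insert_of_notMem ha, Nat.cast_add, Nat.cast_one]
      exact (add_le_add_left ih 1).trans (Ideal.height_add_one_le_of_lt_of_isPrime hlt)

end MvPolynomial

theorem exists_minGens_le {d : ℕ} {k : Type*} [Field k] {I : Ideal (MvPolynomial (Fin d) k)}
    {v : Fin d →₀ ℕ} (hv : monomial v (1 : k) ∈ I) : ∃ w ∈ MinGens I, w ≤ v := by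
  obtain ⟨w, hwv, hw⟩ :=
    exists_minimal_le_of_wellFoundedLT (fun w : Fin d →₀ ℕ => monomial w (1 : k) ∈ I) v hv
  exact ⟨w, ⟨hw.prop, fun u hu hmem => le_antisymm hu (hw.le_of_le hmem hu)⟩, hwv⟩

theorem exists_min_index_of_mem {d : ℕ} {k : Type*} [Field k]
    {I : Ideal (MvPolynomial (Fin d) k)} (hproper : I ≠ ⊤) {v : Fin d →₀ ℕ}
    (hv : monomial v (1 : k) ∈ I) : ∃ i, v i ≠ 0 ∧ ∀ j, v j ≠ 0 → i ≤ j := by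
  have hne : v.support.Nonempty := by
    rw [Finsupp.support_nonempty_iff]
    rintro rfl
    exact hproper ((Ideal.eq_top_iff_one I).2 hv)
  exact ⟨v.support.min' hne, Finsupp.mem_support_iff.1 (v.support.min'_mem hne),
    fun j hj => v.support.min'_le j (Finsupp.mem_support_iff.2 hj)⟩

namespace StronglyStable

variable {d : ℕ} {k : Type*} [Field k] {I : Ideal (MvPolynomial (Fin d) k)}

theorem exists_X_pow_mem_of_add_single (hI : StronglyStable I) (i : Fin d) (u : Fin d →₀ ℕ) :
    ∀ a : ℕ, (∀ j, u j ≠ 0 → i < j) → monomial (u + Finsupp.single i a) (1 : k) ∈ I →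
      ∃ n, (X i : MvPolynomial (Fin d) k) ^ n ∈ I := by
  induction u using WellFoundedLT.induction with
  | ind u ih =>
    intro a hu hmem
    by_cases h0 : u = 0
    · exact ⟨a, by simpa [h0, X_pow_eq_monomial] using hmem⟩
    · obtain ⟨j, hj⟩ := Finsupp.ne_iff.1 h0
      have hj : u j ≠ 0 := hj
      have hij := hu j hj
      have hle : Finsupp.single j 1 ≤ u := by
        simpa [Finsupp.single_le_iff] using Nat.one_le_iff_ne_zero.2 hj
      obtain ⟨w, rfl⟩ := exists_add_of_le hle
      have hlt : w < Finsupp.single j 1 + w :=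
        lt_of_le_of_ne le_add_self fun h => by simpa using DFunLike.congr_fun h j
      refine ih w hlt (a + 1) (fun l hl => hu l fun h => hl ?_) ?_
      · exact (Nat.add_eq_zero_iff.1 h).2
      · convert hI _ hmem i j hij (by simp) using 2
        rw [Finsupp.single_add, add_assoc, add_assoc, add_tsub_cancel_left]

theorem exists_X_pow_mem (hI : StronglyStable I) {v : Fin d →₀ ℕ}
    (hv : monomial v (1 : k) ∈ I) {i : Fin d} (hi : ∀ j, v j ≠ 0 → i ≤ j) :
    ∃ n, (X i : MvPolynomial (Fin d) k) ^ n ∈ I := by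
  refine hI.exists_X_pow_mem_of_add_single i (v.erase i) (v i) (fun j hj => ?_) ?_
  · have hji : j ≠ i := by
      rintro rfl
      simp at hj
    rw [Finsupp.erase_ne hji] at hj
    exact lt_of_le_of_ne (hi j hj) hji.symm
  · rwa [Finsupp.erase_add_single]

end StronglyStable

/-- For a nonzero proper strongly stable monomial ideal `I`,
`ht(I) = max{ min(v) : v ∈ log(G(I)) }`, where `min(v)` is the smallest index in the
support of `v` (counted 1-based, i.e. `i.val + 1` for the 0-based index `i`). -/
theorem stmt_3 {d : ℕ} {k : Type*} [Field k]
    (I : Ideal (MvPolynomial (Fin d) k)) (hmono : IsMonomialIdeal I)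
    (hI : StronglyStable I) (hne : I ≠ ⊥) (hproper : I ≠ ⊤) :
    idealHeight I = sSup {n : ℕ∞ | ∃ v ∈ MinGens I, ∃ i : Fin d,
      v i ≠ 0 ∧ (∀ j : Fin d, v j ≠ 0 → i ≤ j) ∧ n = (i : ℕ) + 1} := by
  classical
  let T : Finset (Fin d) := Finset.univ.filter fun i =>
    ∃ v ∈ MinGens I, v i ≠ 0 ∧ ∀ j : Fin d, v j ≠ 0 → i ≤ j
  obtain ⟨S, hS⟩ := hmono
  have hmem : ∀ v ∈ S, monomial v (1 : k) ∈ I := fun v hv =>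
    hS ▸ Ideal.subset_span ⟨v, hv, rfl⟩
  have hT : ∀ v ∈ S, ∃ i ∈ T, v i ≠ 0 := fun v hv => by
    obtain ⟨w, hw, hwv⟩ := exists_minGens_le (hmem v hv)
    obtain ⟨i, hi, hmin⟩ := exists_min_index_of_mem hproper hw.1
    exact ⟨i, by simpa [T] using ⟨w, hw, hi, hmin⟩,
      ((Nat.pos_of_ne_zero hi).trans_le (hwv i)).ne'⟩
  have hSne : S.Nonempty := by
    rw [Set.nonempty_iff_ne_empty]
    rintro rfl
    exact hne (by simpa using hS)
  obtain ⟨v₀, hv₀⟩ := hSne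
  obtain ⟨i₀, hi₀, -⟩ := hT v₀ hv₀
  obtain ⟨m, hm⟩ := T.exists_maximal ⟨i₀, hi₀⟩
  obtain ⟨v, hv, hvm, hmin⟩ := (Finset.mem_filter.1 hm.prop).2
  have hmax : ∀ i ∈ T, i ≤ m := fun i hi => not_lt.1 (hm.not_gt hi)
  have hsup : sSup {n : ℕ∞ | ∃ v ∈ MinGens I, ∃ i : Fin d,
      v i ≠ 0 ∧ (∀ j : Fin d, v j ≠ 0 → i ≤ j) ∧ n = (i : ℕ) + 1} = (m : ℕ) + 1 := by
    refine IsGreatest.csSup_eq ⟨⟨v, hv, m, hvm, hmin, rfl⟩, ?_⟩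
    rintro _ ⟨w, hw, i, hi, hwi, rfl⟩
    have : i ≤ m := hmax i (by simpa [T] using ⟨w, hw, hi, hwi⟩)
    exact_mod_cast Nat.succ_le_succ this
  let P : Ideal (MvPolynomial (Fin d) k) := Ideal.span (X '' (Finset.Iic m : Set (Fin d)))
  have hPprime : P.IsPrime := isPrime_span_X_image _
  have hPheight : P.height = (m : ℕ) + 1 := by
    rw [height_span_X_image, Fin.card_Iic]
    norm_cast
  have hIP : I ≤ P := by
    rw [hS, Ideal.span_le]
    rintro _ ⟨w, hw, rfl⟩
    obtain ⟨i, hiT, hi⟩ := hT w hw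
    refine mem_ideal_span_X_image.2 fun u hu => ⟨i, by simpa using hmax i hiT, ?_⟩
    rwa [Finset.mem_singleton.1 (support_monomial_subset hu)]
  rw [hsup, ← hPheight]
  refine le_antisymm ?_ (le_iInf₂ fun p hp => ?_)
  · refine (iInf₂_le (⟨P, hPprime⟩ : PrimeSpectrum _) hIP).trans ?_
    rw [← PrimeSpectrum.height_eq_orderHeight]
  · rw [← PrimeSpectrum.height_eq_orderHeight]
    refine Ideal.height_mono (Ideal.span_le.2 ?_)
    rintro _ ⟨i, hi, rfl⟩
    obtain ⟨n, hn⟩ := hI.exists_X_pow_mem hv.1 (i := i)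
      fun j hj => (by simpa using hi : i ≤ m).trans (hmin j hj)
    exact p.2.mem_of_pow_mem n (hp hn)
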